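/- (Lemma 4.8, estimate (4.20) in static form) Let N ≥ 2 be an integer, α ∈ (0,1), and M > 0, and set a = (2 − α)/2. Let u : ℝ^N → ℝ be a smooth function with compact support contained in the open ball B(0, M), and let v : ℝ^N → ℝ be measurable with ∫_{ℝ^N} v(x)² dx < ∞. Then | ∫_{ℝ^N} v(x) ( x·∇u(x) + ((N − a)/2) u(x) ) dx | ≤ M^{(2−α)/2} · ( ∫_{ℝ^N} v(x)² dx )^{1/2} · ( ∫_{ℝ^N} |x|^α |∇u(x)|² dx )^{1/2}. -/

import Mathlib

open MeasureTheory
open scoped RealInnerProductSpace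

theorem aux_cs {X : Type*} [MeasurableSpace X] {μ : Measure X} (f g : X → ℝ)
    (hf : MemLp f 2 μ) (hg : MemLp g 2 μ) :
    |∫ x, f x * g x ∂μ| ≤ Real.sqrt (∫ x, f x ^ 2 ∂μ) * Real.sqrt (∫ x, g x ^ 2 ∂μ) := by
  have h := integral_mul_norm_le_Lp_mul_Lq (μ := μ) (f := f) (g := g)
    Real.HolderConjugate.two_two (by simpa using hf) (by simpa using hg)
  have h1 : |∫ x, f x * g x ∂μ| ≤ ∫ x, ‖f x‖ * ‖g x‖ ∂μ := by
    have := norm_integral_le_integral_norm (μ := μ) (fun x => f x * g x)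
    simpa only [norm_mul, Real.norm_eq_abs] using this
  refine h1.trans (h.trans (le_of_eq ?_))
  rw [Real.sqrt_eq_rpow, Real.sqrt_eq_rpow]
  simp

theorem aux_ibp (N : ℕ) (w : EuclideanSpace ℝ (Fin N) → ℝ)
    (hw : ContDiff ℝ 1 w) (hc : HasCompactSupport w) :
    ∫ x, fderiv ℝ w x x = - (N : ℝ) * ∫ x, w x := by
  let e := EuclideanSpace.basisFun (Fin N) ℝ
  have hint : ∀ F : EuclideanSpace ℝ (Fin N) → ℝ, Continuous F → (∀ x, x ∉ tsupport w → F x = 0) →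
      Integrable F := fun F hF h0 =>
    hF.integrable_of_hasCompactSupport (HasCompactSupport.intro hc.isCompact (fun x hx => h0 x hx))
  have hd0 : ∀ x, x ∉ tsupport w → fderiv ℝ w x = 0 := fun x hx => fderiv_of_notMem_tsupport ℝ hx
  have hw0 : ∀ x, x ∉ tsupport w → w x = 0 := fun x hx => image_eq_zero_of_notMem_tsupport hx
  have hcd : Continuous (fderiv ℝ w) := hw.continuous_fderiv (by norm_num)
  have hcw : Continuous w := hw.continuous
  have hp : ∀ (i : Fin N) (x : EuclideanSpace ℝ (Fin N)),
      fderiv ℝ (fun y : EuclideanSpace ℝ (Fin N) => y i) x (e i) = 1 := by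
    intro i x
    have : (fun y : EuclideanSpace ℝ (Fin N) => y i)
      = (EuclideanSpace.proj i : EuclideanSpace ℝ (Fin N) →L[ℝ] ℝ) := rfl
    rw [this, ContinuousLinearMap.fderiv]
    simp [e]
  have key : ∀ i : Fin N, ∫ x, x i * fderiv ℝ w x (e i) = - ∫ x, w x := by
    intro i
    have := integral_mul_fderiv_eq_neg_fderiv_mul_of_integrable
      (μ := (volume : Measure (EuclideanSpace ℝ (Fin N))))
      (f := fun x : EuclideanSpace ℝ (Fin N) => x i) (g := w) (v := e i) ?_ ?_ ?_ ?_ ?_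
    · rw [this]; simp only [hp, one_mul]
    · simp only [hp, one_mul]; exact hint _ hcw hw0
    · exact hint _ (by fun_prop) (fun x hx => by simp [hd0 x hx])
    · exact hint _ (by fun_prop) (fun x hx => by simp [hw0 x hx])
    · intro x _; fun_prop
    · intro x _; exact hw.differentiable (by norm_num) x
  have hs : ∀ x : EuclideanSpace ℝ (Fin N), fderiv ℝ w x x = ∑ i, x i * fderiv ℝ w x (e i) := by
    intro x
    have h := congrArg (fderiv ℝ w x) (e.sum_repr x)
    rw [map_sum] at h
    rw [← h]
    simp [e]
  simp only [hs]
  rw [integral_finsetSum _ (fun i _ => hint _ (by fun_prop) (fun x hx => by simp [hd0 x hx]))]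
  simp [key]

/-- **Lemma 4.8, estimate (4.20) in static form.**
With `a = (2 − α)/2`, for smooth `u` supported in `B(0,M)` and square-integrable `v`,
`|∫ v (x·∇u + ((N−a)/2) u)| ≤ M^{(2−α)/2} (∫ v²)^{1/2} (∫ |x|^α |∇u|²)^{1/2}`. -/
theorem multiplier_static_estimate (N : ℕ) (hN : 2 ≤ N) (α : ℝ) (hα : α ∈ Set.Ioo (0 : ℝ) 1)
    (M : ℝ) (hM : 0 < M) (a : ℝ) (ha : a = (2 - α) / 2)
    (u : EuclideanSpace ℝ (Fin N) → ℝ)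
    (hu : ContDiff ℝ (⊤ : ℕ∞) u) (hsupp : HasCompactSupport u)
    (hsub : tsupport u ⊆ Metric.ball (0 : EuclideanSpace ℝ (Fin N)) M)
    (v : EuclideanSpace ℝ (Fin N) → ℝ) (hv : Measurable v)
    (hv2 : Integrable (fun x => (v x) ^ 2) (volume : Measure (EuclideanSpace ℝ (Fin N)))) :
    |∫ x : EuclideanSpace ℝ (Fin N),
        v x * (⟪x, gradient u x⟫ + (((N : ℝ) - a) / 2) * u x)|
      ≤ M ^ ((2 - α) / 2) *
          Real.sqrt (∫ x : EuclideanSpace ℝ (Fin N), (v x) ^ 2) *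
          Real.sqrt (∫ x : EuclideanSpace ℝ (Fin N), ‖x‖ ^ α * ‖gradient u x‖ ^ 2) := by
  obtain ⟨hα0, hα1⟩ := hα
  have hint : ∀ F : EuclideanSpace ℝ (Fin N) → ℝ, Continuous F → (∀ x, x ∉ tsupport u → F x = 0) →
      Integrable F := fun F hF h0 =>
    hF.integrable_of_hasCompactSupport (HasCompactSupport.intro hsupp.isCompact (fun x hx => h0 x hx))
  have hd0 : ∀ x, x ∉ tsupport u → fderiv ℝ u x = 0 := fun x hx => fderiv_of_notMem_tsupport ℝ hx
  have hg0 : ∀ x, x ∉ tsupport u → gradient u x = 0 := fun x hx => by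
    simp [gradient, hd0 x hx]
  have hu0 : ∀ x, x ∉ tsupport u → u x = 0 := fun x hx => image_eq_zero_of_notMem_tsupport hx
  have hu1 : ContDiff ℝ 1 u := hu.of_le (by exact_mod_cast le_top)
  have hcd : Continuous (fderiv ℝ u) := hu1.continuous_fderiv (by norm_num)
  have hcg : Continuous (gradient u) :=
    (InnerProductSpace.toDual ℝ (EuclideanSpace ℝ (Fin N))).symm.continuous.comp hcd
  have hcu : Continuous u := hu1.continuous
  have hin : ∀ x, ⟪x, gradient u x⟫ = fderiv ℝ u x x := fun x => by simp
  set c : ℝ := ((N : ℝ) - a) / 2 with hc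
  have hN' : (2 : ℝ) ≤ N := by exact_mod_cast hN
  set G : EuclideanSpace ℝ (Fin N) → ℝ := fun x => ⟪x, gradient u x⟫ + c * u x with hG
  have hGc : Continuous G := by fun_prop
  have hG2 : Integrable (fun x => G x ^ 2) :=
    hint _ (by fun_prop) (fun x hx => by simp [hG, hd0 x hx, hu0 x hx])
  have hcs := aux_cs (μ := volume) v G ((memLp_two_iff_integrable_sq hv.aestronglyMeasurable).2 hv2)
    ((memLp_two_iff_integrable_sq hGc.aestronglyMeasurable).2 hG2)
  have hibp : ∫ x, 2 * u x * ⟪x, gradient u x⟫ = - (N : ℝ) * ∫ x, u x ^ 2 := by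
    rw [← aux_ibp N (fun x => u x ^ 2) (hu1.pow 2)
      (HasCompactSupport.intro hsupp.isCompact (fun x hx => by simp [hu0 x hx]))]
    congr 1
    ext x
    have := ((hu1.differentiable (by norm_num) x).hasFDerivAt.pow 2).fderiv
    rw [hin, this]
    simp
  have hI1 : Integrable (fun x => ⟪x, gradient u x⟫ ^ 2) :=
    hint _ (by fun_prop) (fun x hx => by simp [hg0 x hx, hd0 x hx])
  have hI2 : Integrable (fun x => 2 * u x * ⟪x, gradient u x⟫) :=
    hint _ (by fun_prop) (fun x hx => by simp [hg0 x hx, hd0 x hx])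
  have hI3 : Integrable (fun x => u x ^ 2) :=
    hint _ (by fun_prop) (fun x hx => by simp [hu0 x hx])
  have hI4 : Integrable (fun x => ‖x‖ ^ α * ‖gradient u x‖ ^ 2) :=
    hint _ ((continuous_norm.rpow_const (fun x => Or.inr hα0.le)).mul (by fun_prop))
      (fun x hx => by simp [hg0 x hx, hd0 x hx])
  have hexp : ∫ x, G x ^ 2 = (∫ x, ⟪x, gradient u x⟫ ^ 2) + (c ^ 2 - c * N) * ∫ x, u x ^ 2 := by
    have : (fun x => G x ^ 2) = fun x => (⟪x, gradient u x⟫ ^ 2 +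
        c * (2 * u x * ⟪x, gradient u x⟫)) + c ^ 2 * u x ^ 2 := by
      ext x; simp only [hG]; ring
    have hI5 : Integrable (fun x => ⟪x, gradient u x⟫ ^ 2 + c * (2 * u x * ⟪x, gradient u x⟫)) :=
      hI1.add (hI2.const_mul c)
    rw [this, integral_add hI5 (hI3.const_mul _),
      integral_add hI1 (hI2.const_mul c), integral_const_mul, integral_const_mul, hibp]
    ring
  have hneg : (c ^ 2 - c * N) * ∫ x, u x ^ 2 ≤ 0 := by
    refine mul_nonpos_of_nonpos_of_nonneg ?_ (integral_nonneg fun x => sq_nonneg _)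
    have h1 : 0 ≤ c := by rw [hc, ha]; linarith
    have h2 : c ≤ N := by rw [hc, ha]; linarith
    nlinarith
  have hpt : ∀ x, ⟪x, gradient u x⟫ ^ 2 ≤
      (M ^ ((2 - α) / 2)) ^ 2 * (‖x‖ ^ α * ‖gradient u x‖ ^ 2) := by
    intro x
    by_cases hx : x ∈ tsupport u
    · have hxM : ‖x‖ ≤ M := (mem_ball_zero_iff.1 (hsub hx)).le
      have h1 : ⟪x, gradient u x⟫ ^ 2 ≤ (‖x‖ * ‖gradient u x‖) ^ 2 :=
        sq_le_sq' (by linarith [neg_abs_le ⟪x, gradient u x⟫, abs_real_inner_le_norm x (gradient u x)])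
          (real_inner_le_norm _ _)
      have h2 : ‖x‖ ^ 2 ≤ (M ^ ((2 - α) / 2)) ^ 2 * ‖x‖ ^ α := by
        have e1 : (M ^ ((2 - α) / 2)) ^ 2 = M ^ (2 - α) := by
          rw [← Real.rpow_natCast, ← Real.rpow_mul hM.le]; congr 1; push_cast; ring
        have e2 : ‖x‖ ^ 2 = ‖x‖ ^ (2 - α) * ‖x‖ ^ α := by
          rw [← Real.rpow_add' (norm_nonneg x) (by norm_num)]; norm_num
        rw [e1, e2]
        gcongr
        linarith
      calc _ ≤ _ := h1
        _ = ‖x‖ ^ 2 * ‖gradient u x‖ ^ 2 := by ring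
        _ ≤ ((M ^ ((2 - α) / 2)) ^ 2 * ‖x‖ ^ α) * ‖gradient u x‖ ^ 2 := by gcongr
        _ = _ := by ring
    · simp [hg0 x hx, hd0 x hx]
  have hle : ∫ x, G x ^ 2 ≤ (M ^ ((2 - α) / 2)) ^ 2 * ∫ x, ‖x‖ ^ α * ‖gradient u x‖ ^ 2 := by
    have := integral_mono hI1 (hI4.const_mul ((M ^ ((2 - α) / 2)) ^ 2)) hpt
    rw [integral_const_mul] at this
    linarith
  have hsq : Real.sqrt (∫ x, G x ^ 2) ≤
      M ^ ((2 - α) / 2) * Real.sqrt (∫ x, ‖x‖ ^ α * ‖gradient u x‖ ^ 2) := by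
    refine (Real.sqrt_le_sqrt hle).trans (le_of_eq ?_)
    rw [Real.sqrt_mul (sq_nonneg _), Real.sqrt_sq (by positivity)]
  refine hcs.trans ((mul_le_mul_of_nonneg_left hsq (Real.sqrt_nonneg _)).trans (le_of_eq ?_))
  ring
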